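/- arXiv:2005.14068 — 2 statements merged into one kernel-verified Lean document; each statement's English description precedes it below -/
import Mathlib

section
/- Let r be a table over attributes A and B with a strict linear order <_A on D_A. Let G_1, ..., G_p be the partition groups of r by A-value, listed in increasing <_A order of their A-values, and define the relation B[τ_A] on D_B by: b ≺ b' whenever b ≠ b', some tuple of G_i has B-value b, and some tuple of G_{i+1} has B-value b', for some 1 ≤ i < p. Then the explicit-to-implicit candidate A ~ B* is valid iff the transitive closure of B[τ_A] is a weak total order on D_B. -/
/-- A witness order for the explicit-to-implicit candidate `A ~ B*`. -/
structure IsEIWitness {T α β : Type*} [LinearOrder α] (fA : T → α) (fB : T → β)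
    (w : T → T → Prop) : Prop where
  total : ∀ s t : T, s ≠ t → w s t ∨ w t s
  irrefl : ∀ s : T, ¬ w s s
  trans : ∀ s t u : T, w s t → w t u → w s u
  compat : ∀ s t : T, w s t → ¬ (fA t < fA s)
  interval : ∀ s t u : T, w s t → w t u → fB s = fB u → fB s = fB t

/-- `x` and `y` are A-values of consecutive partition groups of the table by
A-value (both occur, `x < y`, and no occurring A-value lies strictly between). -/
def ConsecA {T α : Type*} [LinearOrder α] (fA : T → α) (x y : α) : Prop :=
  (∃ t : T, fA t = x) ∧ (∃ t : T, fA t = y) ∧ x < y ∧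
    ¬ ∃ z : α, (∃ t : T, fA t = z) ∧ x < z ∧ z < y

/-- The relation `B[τ_A]`: `b ≺ b'` whenever `b ≠ b'`, some tuple of a group
`G_i` has B-value `b`, and some tuple of the next group `G_{i+1}` has
B-value `b'`. -/
def BtauA {T α β : Type*} [LinearOrder α] (fA : T → α) (fB : T → β) (b b' : β) : Prop :=
  b ≠ b' ∧ ∃ s t : T, fB s = b ∧ fB t = b' ∧ ConsecA fA (fA s) (fA t)

/-- A relation `R` is a weak total order on the set `S`: there is a partition
of `S` into linearly ordered blocks (indexed here by `Fin k`) such that for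
`x, y ∈ S`, `R x y` holds iff the block of `x` precedes the block of `y`. -/
def IsWeakTotalOrderOn {β : Type*} (S : Set β) (R : β → β → Prop) : Prop :=
  ∃ (k : ℕ) (g : β → Fin k), ∀ b ∈ S, ∀ b' ∈ S, (R b b' ↔ g b < g b')

lemma btau_path {T α β : Type*} [Fintype T] [LinearOrder α] (fA : T → α) (fB : T → β) :
    ∀ (n : ℕ) (s t : T), (Finset.univ.filter (fun x => fA s < fA x ∧ fA x < fA t)).card ≤ n →
      fA s < fA t → Relation.ReflTransGen (BtauA fA fB) (fB s) (fB t) := by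
  intro n
  induction n with
  | zero =>
    intro s t hc hst
    by_cases hb : fB s = fB t
    · rw [hb]
    · refine Relation.ReflTransGen.single ⟨hb, s, t, rfl, rfl, ⟨s, rfl⟩, ⟨t, rfl⟩, hst, ?_⟩
      rintro ⟨z, ⟨x, rfl⟩, h1, h2⟩
      have : x ∈ (Finset.univ.filter (fun x => fA s < fA x ∧ fA x < fA t)) := by simp [h1, h2]
      have := Finset.card_pos.mpr ⟨x, this⟩
      omega
  | succ n ih =>
    intro s t hc hst
    by_cases hz : ∃ x, fA s < fA x ∧ fA x < fA t
    · obtain ⟨x, h1, h2⟩ := hz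
      have hx : x ∈ (Finset.univ.filter (fun x => fA s < fA x ∧ fA x < fA t)) := by simp [h1, h2]
      refine (ih s x ?_ h1).trans (ih x t ?_ h2)
      · refine Nat.le_of_lt_succ (lt_of_lt_of_le (Finset.card_lt_card ?_) hc)
        refine (Finset.ssubset_iff_of_subset ?_).mpr ⟨x, hx, by simp⟩
        intro y
        simp only [Finset.mem_filter, Finset.mem_univ, true_and]
        exact fun h => ⟨h.1, h.2.trans h2⟩
      · refine Nat.le_of_lt_succ (lt_of_lt_of_le (Finset.card_lt_card ?_) hc)
        refine (Finset.ssubset_iff_of_subset ?_).mpr ⟨x, hx, by simp⟩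
        intro y
        simp only [Finset.mem_filter, Finset.mem_univ, true_and]
        exact fun h => ⟨h1.trans h.1, h.2⟩
    · by_cases hb : fB s = fB t
      · rw [hb]
      · refine Relation.ReflTransGen.single ⟨hb, s, t, rfl, rfl, ⟨s, rfl⟩, ⟨t, rfl⟩, hst, ?_⟩
        rintro ⟨z, ⟨x, rfl⟩, h1, h2⟩
        exact hz ⟨x, h1, h2⟩

lemma btau_trans {T α β : Type*} [Fintype T] [LinearOrder α] (fA : T → α) (fB : T → β)
    (s t : T) (h : fA s < fA t) (hb : fB s ≠ fB t) :
    Relation.TransGen (BtauA fA fB) (fB s) (fB t) := by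
  rcases Relation.reflTransGen_iff_eq_or_transGen.mp (btau_path fA fB _ s t le_rfl h) with h | h
  · exact absurd h.symm hb
  · exact h

/-- Distinct values, some tuple of the first strictly A-below some tuple of the second. -/
def RelR {T α β : Type*} [LinearOrder α] (fA : T → α) (fB : T → β) (b c : β) : Prop :=
  b ≠ c ∧ ∃ s t : T, fB s = b ∧ fB t = c ∧ fA s < fA t

/-- In a witness order, blocks compare uniformly. -/
lemma witness_block {T α β : Type*} [LinearOrder α] {fA : T → α} {fB : T → β}
    {w : T → T → Prop} (hw : IsEIWitness fA fB w) {s t s' t' : T} (h : w s t)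
    (hb : fB s ≠ fB t) (hs : fB s' = fB s) (ht : fB t' = fB t) : w s' t' := by
  have key : w s' t := by
    by_contra hn
    have hne : t ≠ s' := by rintro rfl; exact hb hs.symm
    rcases hw.total _ _ hne with h1 | h1
    · exact hb (hw.interval _ _ _ h h1 hs.symm)
    · exact hn h1
  by_contra hn
  have hne : t' ≠ s' := by rintro rfl; exact hb (hs.symm.trans ht)
  rcases hw.total _ _ hne with h1 | h1
  · exact hb (hs.symm.trans ((hw.interval _ _ _ h1 key ht).symm.trans ht))
  · exact hn h1

lemma witness_of_lt {T α β : Type*} [LinearOrder α] {fA : T → α} {fB : T → β}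
    {w : T → T → Prop} (hw : IsEIWitness fA fB w) {s t : T} (h : fA s < fA t) : w s t := by
  have hne : s ≠ t := by rintro rfl; exact lt_irrefl _ h
  rcases hw.total _ _ hne with h1 | h1
  · exact h1
  · exact absurd h (hw.compat _ _ h1)

lemma relR_trans {T α β : Type*} [LinearOrder α] {fA : T → α} {fB : T → β}
    {w : T → T → Prop} (hw : IsEIWitness fA fB w) {b c d : β}
    (h1 : RelR fA fB b c) (h2 : RelR fA fB c d) : RelR fA fB b d := by
  obtain ⟨hbc, s, t, rfl, rfl, hst⟩ := h1
  obtain ⟨hcd, t', u, ht', rfl, htu⟩ := h2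
  have wst := witness_of_lt hw hst
  have wtu := witness_of_lt hw htu
  have wst' : w s t' := witness_block hw wst hbc rfl ht'
  have hne : fB s ≠ fB u := by
    intro he
    exact hbc ((hw.interval _ _ _ wst' wtu he).trans ht')
  have wsu := hw.trans _ _ _ wst' wtu
  refine ⟨hne, s, u, rfl, rfl, ?_⟩
  exact lt_of_le_of_lt (not_lt.mp (hw.compat _ _ wst')) htu

lemma transGen_iff_relR {T α β : Type*} [Fintype T] [LinearOrder α] {fA : T → α} {fB : T → β}
    {w : T → T → Prop} (hw : IsEIWitness fA fB w) (b c : β) :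
    Relation.TransGen (BtauA fA fB) b c ↔ RelR fA fB b c := by
  have step : ∀ b c, BtauA fA fB b c → RelR fA fB b c := by
    rintro b c ⟨hne, s, t, h1, h2, h3⟩
    exact ⟨hne, s, t, h1, h2, h3.2.2.1⟩
  constructor
  · intro h
    induction h with
    | single h => exact step _ _ h
    | tail _ h ih => exact relR_trans hw ih (step _ _ h)
  · rintro ⟨hne, s, t, rfl, rfl, h⟩
    exact btau_trans fA fB s t h hne

lemma relR_neg {T α β : Type*} [LinearOrder α] {fA : T → α} {fB : T → β} {b c : β} (v : T)
    (h : RelR fA fB b c) : RelR fA fB b (fB v) ∨ RelR fA fB (fB v) c := by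
  by_cases h1 : b = fB v
  · exact Or.inr (h1 ▸ h)
  by_cases h2 : fB v = c
  · exact Or.inl (h2 ▸ h)
  obtain ⟨hbc, s, t, hs, ht, hst⟩ := h
  rcases lt_or_ge (fA s) (fA v) with h3 | h3
  · exact Or.inl ⟨h1, s, v, hs, rfl, h3⟩
  · exact Or.inr ⟨h2, v, t, rfl, ht, lt_of_le_of_lt h3 hst⟩

lemma weak_of_witness {T α β : Type*} [Fintype T] [LinearOrder α] {fA : T → α} {fB : T → β}
    {w : T → T → Prop} (hw : IsEIWitness fA fB w) :
    IsWeakTotalOrderOn (Set.range fB) (Relation.TransGen (BtauA fA fB)) := by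
  classical
  refine ⟨Fintype.card T + 1, fun b =>
    ⟨(Finset.univ.filter (fun t => RelR fA fB (fB t) b)).card,
      Nat.lt_succ_of_le (Finset.card_le_univ _)⟩, ?_⟩
  rintro _ ⟨s, rfl⟩ _ ⟨t, rfl⟩
  rw [transGen_iff_relR hw, Fin.mk_lt_mk]
  constructor
  · intro h
    refine Finset.card_lt_card ((Finset.ssubset_iff_of_subset ?_).mpr ⟨s, by simpa using h, ?_⟩)
    · intro y
      simp only [Finset.mem_filter, Finset.mem_univ, true_and]
      exact fun h' => relR_trans hw h' h
    · simp only [Finset.mem_filter, Finset.mem_univ, true_and]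
      exact fun h' => h'.1 rfl
  · intro h
    by_contra hn
    refine absurd h (not_lt.mpr (Finset.card_le_card ?_))
    intro y
    simp only [Finset.mem_filter, Finset.mem_univ, true_and]
    intro hy
    exact (relR_neg s hy).resolve_right hn

lemma witness_of_weak {T α β : Type*} [Fintype T] [LinearOrder α] {fA : T → α} {fB : T → β}
    (h : IsWeakTotalOrderOn (Set.range fB) (Relation.TransGen (BtauA fA fB))) :
    ∃ w : T → T → Prop, IsEIWitness fA fB w := by
  classical
  obtain ⟨k, g, hg⟩ := h
  letI : LinearOrder β := linearOrderOfSTO WellOrderingRel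
  letI : LinearOrder T := linearOrderOfSTO WellOrderingRel
  have hA : ∀ s t, fB s ≠ fB t → fA s < fA t → g (fB s) < g (fB t) := fun s t hne hlt =>
    (hg _ ⟨s, rfl⟩ _ ⟨t, rfl⟩).mp (btau_trans fA fB s t hlt hne)
  let kB : β → Fin k ×ₗ β := fun b => toLex (g b, b)
  have kBinj : ∀ b c, kB b = kB c → b = c := by
    intro b c h
    exact congrArg (fun x => (ofLex x).2) h
  let key : T → (Fin k ×ₗ β) ×ₗ (α ×ₗ T) := fun t => toLex (kB (fB t), toLex (fA t, t))
  have keyinj : ∀ s t, key s = key t → s = t := by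
    intro s t h
    exact congrArg (fun x => (ofLex (ofLex x).2).2) h
  have mono : ∀ s t, key s < key t → kB (fB s) ≤ kB (fB t) := by
    intro s t h
    rcases (Prod.Lex.lt_iff).mp h with h | h
    · exact le_of_lt h
    · exact le_of_eq h.1
  refine ⟨fun s t => key s < key t, ?_, ?_, ?_, ?_, ?_⟩
  · intro s t hne
    exact lt_or_gt_of_ne (fun h => hne (keyinj s t h))
  · exact fun s => lt_irrefl _
  · exact fun s t u h1 h2 => lt_trans h1 h2
  · intro s t hst hlt
    by_cases hb : fB s = fB t
    · rcases (Prod.Lex.lt_iff).mp hst with h | h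
      · exact absurd h (by change ¬ kB (fB s) < kB (fB t); rw [hb]; exact lt_irrefl _)
      · rcases (Prod.Lex.lt_iff).mp h.2 with h | h
        · exact lt_asymm h hlt
        · exact hlt.ne h.1.symm
    · have h1 := hA t s (Ne.symm hb) hlt
      have h2 : kB (fB t) < kB (fB s) := Prod.Lex.lt_iff.mpr (Or.inl h1)
      exact absurd h2 (not_lt.mpr (mono s t hst))
  · intro s t u h1 h2 he
    apply kBinj
    apply le_antisymm (mono s t h1)
    rw [he]
    exact mono t u h2

/-- The explicit-to-implicit candidate `A ~ B*` is valid iff the transitive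
closure of the relation `B[τ_A]` is a weak total order on the occurring
B-values. -/
theorem stmt3 {T α β : Type*} [Fintype T] [Nonempty T] [LinearOrder α]
    (fA : T → α) (fB : T → β) :
    (∃ w : T → T → Prop, IsEIWitness fA fB w) ↔
      IsWeakTotalOrderOn (Set.range fB) (Relation.TransGen (BtauA fA fB)) :=
  ⟨fun ⟨_, hw⟩ => weak_of_witness hw, witness_of_weak⟩
end

section
/- Let r be a finite set of tuples over a schema whose attributes have linearly ordered domains, and let X and Y be lists of attributes. Then the order dependency X ↦ Y holds in r iff both X ↦ XY holds in r and X ~ Y holds in r (where X ~ Y means XY ↦ YX and YX ↦ XY, with juxtaposition denoting list concatenation). -/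
/-- Lexicographic comparison of two tuples with respect to a list of
attributes: `s ⪯_X t`. -/
def lexLe {A : Type*} {D : A → Type*} [∀ a, LinearOrder (D a)] :
    List A → (∀ a, D a) → (∀ a, D a) → Prop
  | [], _, _ => True
  | a :: X, s, t => s a < t a ∨ (s a = t a ∧ lexLe X s t)

/-- The order dependency `X ↦ Y` holds in `r`. -/
def ODholds {A : Type*} {D : A → Type*} [∀ a, LinearOrder (D a)]
    (r : Set (∀ a, D a)) (X Y : List A) : Prop :=
  ∀ s ∈ r, ∀ t ∈ r, lexLe X s t → lexLe Y s t

theorem lexLe_total' {A : Type*} {D : A → Type*} [∀ a, LinearOrder (D a)]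
    (X : List A) (s t : ∀ a, D a) : lexLe X s t ∨ lexLe X t s := by
  induction X with
  | nil => exact Or.inl trivial
  | cons a X ih =>
    simp only [lexLe]
    rcases lt_trichotomy (s a) (t a) with h | h | h
    · exact Or.inl (Or.inl h)
    · rcases ih with k | k
      · exact Or.inl (Or.inr ⟨h, k⟩)
      · exact Or.inr (Or.inr ⟨h.symm, k⟩)
    · exact Or.inr (Or.inl h)

theorem lexLe_append' {A : Type*} {D : A → Type*} [∀ a, LinearOrder (D a)]
    (X Y : List A) (s t : ∀ a, D a) :
    lexLe (X ++ Y) s t ↔ lexLe X s t ∧ (lexLe X t s → lexLe Y s t) := by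
  induction X with
  | nil => simp [lexLe]
  | cons a X ih =>
    simp only [List.cons_append, lexLe, ih]
    rcases lt_trichotomy (s a) (t a) with h | h | h
    · simp [h, h.ne', h.not_gt]
    · simp [h]
    · simp [h.ne', h.not_gt]

/-- The order dependency `X ↦ Y` holds in a finite set of tuples `r` iff both
`X ↦ XY` holds in `r` and `X ~ Y` holds in `r`, where `X ~ Y` (order
compatibility) means `XY ↦ YX` and `YX ↦ XY`, with juxtaposition denoting
list concatenation. -/
theorem stmt15 {A : Type*} {D : A → Type*} [∀ a, LinearOrder (D a)]
    (r : Set (∀ a, D a)) (hfin : r.Finite) (X Y : List A) :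
    ODholds r X Y ↔
      (ODholds r X (X ++ Y) ∧
        (ODholds r (X ++ Y) (Y ++ X) ∧ ODholds r (Y ++ X) (X ++ Y))) := by
  constructor
  · intro h
    refine ⟨fun s hs t ht hx => ?_, fun s hs t ht hx => ?_, fun s hs t ht hx => ?_⟩
    · exact (lexLe_append' _ _ _ _).2 ⟨hx, fun _ => h s hs t ht hx⟩
    · have hx := ((lexLe_append' _ _ _ _).1 hx).1
      exact (lexLe_append' _ _ _ _).2 ⟨h s hs t ht hx, fun _ => hx⟩
    · obtain ⟨h1, h2⟩ := (lexLe_append' _ _ _ _).1 hx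
      refine (lexLe_append' _ _ _ _).2 ⟨?_, fun _ => h1⟩
      rcases lexLe_total' X s t with k | k
      · exact k
      · exact h2 (h t ht s hs k)
  · rintro ⟨h1, h2, -⟩ s hs t ht hx
    exact ((lexLe_append' _ _ _ _).1 (h2 s hs t ht (h1 s hs t ht hx))).1
end
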